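/- Let f : ℝ^d → ℝ be nonnegative, γ-smooth, and satisfy ‖∇f(θ)‖ ≤ ζ for all θ. Fix T ≥ 1, set η = 1/(γ√T), and let ρ_0, …, ρ_{T−1} satisfy 0 ≤ ρ_t ≤ κ/√T for a constant κ > 0. Starting from any θ_0, define the deterministic full-batch SAM iteration θ_{t+1} = θ_t − η ∇f(θ_t + ρ_t u_t), where each u_t ∈ ℝ^d is a unit vector (‖u_t‖ = 1). Then min_{0 ≤ t ≤ T−1} ‖∇f(θ_t)‖² ≤ (γ f(θ_0) + γζκ + ζ² + γ²κ²)/√T. -/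

import Mathlib

open RealInnerProductSpace

/-- A function with `γ`-Lipschitz gradient deviates from its linearization at `x` by at most
`γ * ‖y - x‖ ^ 2`. -/
lemma le_linearization_add_of_gradient_lipschitz
    {E : Type*} [NormedAddCommGroup E] [InnerProductSpace ℝ E] [CompleteSpace E]
    {f : E → ℝ} {γ : ℝ} (hγ : 0 ≤ γ) (hdiff : Differentiable ℝ f)
    (hsmooth : ∀ x y : E, ‖gradient f x - gradient f y‖ ≤ γ * ‖x - y‖) (x y : E) :
    f y ≤ f x + ⟪gradient f x, y - x⟫ + γ * ‖y - x‖ ^ 2 := by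
  have hx : x ∈ Metric.closedBall x ‖y - x‖ := by simp
  have hy : y ∈ Metric.closedBall x ‖y - x‖ := by simp [dist_eq_norm]
  have h := (convex_closedBall x ‖y - x‖).norm_image_sub_le_of_norm_hasFDerivWithin_le'
    (f := f) (f' := fun z => InnerProductSpace.toDual ℝ E (gradient f z))
    (φ := InnerProductSpace.toDual ℝ E (gradient f x)) (C := γ * ‖y - x‖)
    (fun z _ => (hdiff z).hasGradientAt.hasFDerivAt.hasFDerivWithinAt)
    (fun z hz => by
      rw [← map_sub, LinearIsometryEquiv.norm_map]
      refine (hsmooth z x).trans ?_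
      rw [Metric.mem_closedBall, dist_eq_norm] at hz
      gcongr) hx hy
  rw [InnerProductSpace.toDual_apply_apply, Real.norm_eq_abs] at h
  linarith [le_of_abs_le h]

/-- One gradient step of size `η` taken with the gradient at a point `z` within distance `r`
of `x`. -/
lemma perturbed_gradient_step_le
    {E : Type*} [NormedAddCommGroup E] [InnerProductSpace ℝ E] [CompleteSpace E]
    {f : E → ℝ} {γ ζ η r : ℝ} (hγ : 0 ≤ γ) (hη : 0 ≤ η) (hdiff : Differentiable ℝ f)
    (hsmooth : ∀ x y : E, ‖gradient f x - gradient f y‖ ≤ γ * ‖x - y‖)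
    (hbound : ∀ x : E, ‖gradient f x‖ ≤ ζ) (x z : E) (hz : ‖z - x‖ ≤ r) :
    f (x - η • gradient f z) ≤
      f x - η * ‖gradient f x‖ ^ 2 + η * (ζ * (γ * r)) + γ * (η ^ 2 * ζ ^ 2) := by
  have hζ : 0 ≤ ζ := (norm_nonneg _).trans (hbound x)
  have hstep := le_linearization_add_of_gradient_lipschitz hγ hdiff hsmooth x
    (x - η • gradient f z)
  rw [sub_sub_cancel_left, inner_neg_right, inner_smul_right, norm_neg, norm_smul, mul_pow,
    Real.norm_eq_abs, sq_abs] at hstep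
  have hdist : ‖gradient f x - gradient f z‖ ≤ γ * r := by
    rw [norm_sub_rev]
    exact (hsmooth z x).trans (by gcongr)
  have hinner : ‖gradient f x‖ ^ 2 - ζ * (γ * r) ≤ ⟪gradient f x, gradient f z⟫ := by
    have h := real_inner_le_norm (gradient f x) (gradient f x - gradient f z)
    rw [inner_sub_right, real_inner_self_eq_norm_sq] at h
    have := mul_le_mul (hbound x) hdist (norm_nonneg _) hζ
    linarith
  have hsq : γ * (η ^ 2 * ‖gradient f z‖ ^ 2) ≤ γ * (η ^ 2 * ζ ^ 2) := by
    gcongr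
    exact hbound z
  have := mul_le_mul_of_nonneg_left hinner hη
  linarith

/-- convergence of the deterministic full-batch SAM iteration
`θ_{t+1} = θ_t - η • ∇f(θ_t + ρ_t • u_t)` with `η = 1/(γ√T)`, radii
`0 ≤ ρ_t ≤ κ/√T`, and arbitrary unit directions `u_t`, for a nonnegative
`γ`-smooth `f` with gradients bounded by `ζ`:
`min_{0 ≤ t ≤ T-1} ‖∇f(θ_t)‖² ≤ (γ f(θ_0) + γζκ + ζ² + γ²κ²)/√T`. -/
theorem deterministic_sam_convergence
    {d : ℕ} (f : EuclideanSpace ℝ (Fin d) → ℝ) (γ ζ κ : ℝ)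
    (hγ : 0 < γ) (hκ : 0 < κ)
    (hfnonneg : ∀ x, 0 ≤ f x)
    (hdiff : Differentiable ℝ f)
    (hsmooth : ∀ x y : EuclideanSpace ℝ (Fin d),
      ‖gradient f x - gradient f y‖ ≤ γ * ‖x - y‖)
    (hbound : ∀ x : EuclideanSpace ℝ (Fin d), ‖gradient f x‖ ≤ ζ)
    (T : ℕ) (hT : 1 ≤ T)
    (η : ℝ) (hη : η = 1 / (γ * Real.sqrt T))
    (ρ : ℕ → ℝ) (hρ : ∀ t < T, 0 ≤ ρ t ∧ ρ t ≤ κ / Real.sqrt T)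
    (u : ℕ → EuclideanSpace ℝ (Fin d)) (hu : ∀ t < T, ‖u t‖ = 1)
    (θ : ℕ → EuclideanSpace ℝ (Fin d))
    (hupdate : ∀ t < T, θ (t + 1) = θ t - η • gradient f (θ t + ρ t • u t)) :
    (Finset.range T).inf' (Finset.nonempty_range_iff.mpr (by omega))
        (fun t => ‖gradient f (θ t)‖ ^ 2)
      ≤ (γ * f (θ 0) + γ * ζ * κ + ζ ^ 2 + γ ^ 2 * κ ^ 2) / Real.sqrt T := by
  set m := (Finset.range T).inf' (Finset.nonempty_range_iff.mpr (by omega))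
    (fun t => ‖gradient f (θ t)‖ ^ 2) with hm
  have hmin : ∀ t < T, m ≤ ‖gradient f (θ t)‖ ^ 2 := fun t ht =>
    Finset.inf'_le (fun t => ‖gradient f (θ t)‖ ^ 2) (Finset.mem_range.mpr ht)
  have hTpos : (0 : ℝ) < T := by exact_mod_cast hT
  set s := Real.sqrt T with hs
  have hspos : 0 < s := Real.sqrt_pos.mpr hTpos
  have hsT : (T : ℝ) = s ^ 2 := (Real.sq_sqrt hTpos.le).symm
  have hηpos : 0 < η := by rw [hη]; positivity
  have hsum : ∀ n ≤ T, f (θ n) ≤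
      f (θ 0) + n * (-(η * m) + η * (ζ * (γ * (κ / s))) + γ * (η ^ 2 * ζ ^ 2)) := by
    intro n
    induction n with
    | zero => simp
    | succ n ih =>
      intro hn
      have hz : ‖θ n + ρ n • u n - θ n‖ ≤ κ / s := by
        rw [add_sub_cancel_left, norm_smul, hu n hn, mul_one, Real.norm_eq_abs,
          abs_of_nonneg (hρ n hn).1]
        exact (hρ n hn).2
      have hstep := perturbed_gradient_step_le hγ.le hηpos.le hdiff hsmooth hbound _ _ hz
      rw [← hupdate n hn] at hstep
      have := mul_le_mul_of_nonneg_left (hmin n hn) hηpos.le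
      push_cast
      linarith [ih (by omega)]
  have hfinal := (hfnonneg (θ T)).trans (hsum T le_rfl)
  have hrescale : γ * (f (θ 0) +
      T * (-(η * m) + η * (ζ * (γ * (κ / s))) + γ * (η ^ 2 * ζ ^ 2))) =
      γ * f (θ 0) + γ * ζ * κ + ζ ^ 2 - m * s := by
    rw [hsT, hη]
    field_simp
    ring
  have := mul_nonneg hγ.le hfinal
  rw [le_div_iff₀ hspos]
  nlinarith [mul_nonneg (sq_nonneg γ) (sq_nonneg κ)]
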